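/- Let δ : ℝ → [0, ∞) be a probability density, let m, σ > 0, let λ_1,…,λ_m ∈ ℝ with ∑_{i=1}^m λ_i² = 1, let y_1,…,y_m ∈ ℝ with weighted average s̃ = ∑_{i=1}^m λ_i² y_i, and suppose the integral I = ∫_ℝ exp(−(m/(2σ²)) ∑_{i=1}^m λ_i² (y_i − s)²) δ(s) ds is positive. Then, with f(s, σ) = −log( ∫_ℝ exp(−(m/(2σ²)) z²) δ(s − z) dz ), one has the exact identity −log I = ∑_{i=1}^m (m/(2σ²)) λ_i² (y_i − s̃)² + f(s̃, σ); moreover, if δ(s) = ½ N(s; 0, 1/2) + ½ N(s; 0, 3/2), then f(s, σ) = −½ log(2πσ²/m) − log( ½ N(s; 0, 1/2 + σ²/m) + ½ N(s; 0, 3/2 + σ²/m) ). -/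

import Mathlib

open MeasureTheory Finset Real

/-- The one-dimensional Gaussian probability density with mean `μ` and variance `v`. -/
noncomputable def gaussPDF (x μ v : ℝ) : ℝ :=
  (Real.sqrt (2 * Real.pi * v))⁻¹ * Real.exp (-(x - μ) ^ 2 / (2 * v))

lemma gauss_conv_aux (s v w z : ℝ) (hv : 0 < v) (hw : 0 < w) :
    Real.exp (-(1 / (2 * w)) * z ^ 2) * gaussPDF (s - z) 0 v
      = ((Real.sqrt (2 * Real.pi * v))⁻¹ * Real.exp (-(s - 0) ^ 2 / (2 * (v + w))))
        * Real.exp (-((v + w) / (2 * v * w)) * (z - s * w / (v + w)) ^ 2) := by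
  unfold gaussPDF
  rw [mul_left_comm, mul_assoc (Real.sqrt (2 * Real.pi * v))⁻¹, ← Real.exp_add, ← Real.exp_add]
  congr 2
  have : v + w ≠ 0 := by positivity
  field_simp
  ring

lemma gauss_conv_integrable (s v w : ℝ) (hv : 0 < v) (hw : 0 < w) :
    Integrable (fun z : ℝ => Real.exp (-(1 / (2 * w)) * z ^ 2) * gaussPDF (s - z) 0 v) := by
  simp_rw [fun z => gauss_conv_aux s v w z hv hw]
  have hb : 0 < (v + w) / (2 * v * w) := by positivity
  exact ((integrable_exp_neg_mul_sq hb).comp_sub_right (s * w / (v + w))).const_mul _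

lemma gauss_conv_integral (s v w : ℝ) (hv : 0 < v) (hw : 0 < w) :
    ∫ z : ℝ, Real.exp (-(1 / (2 * w)) * z ^ 2) * gaussPDF (s - z) 0 v
      = Real.sqrt (2 * Real.pi * w) * gaussPDF s 0 (v + w) := by
  simp_rw [fun z => gauss_conv_aux s v w z hv hw]
  rw [integral_const_mul,
    integral_sub_right_eq_self
      (fun z : ℝ => Real.exp (-((v + w) / (2 * v * w)) * z ^ 2)) (s * w / (v + w)),
    integral_gaussian]
  unfold gaussPDF
  have h : (Real.sqrt (2 * Real.pi * v))⁻¹ * Real.sqrt (Real.pi / ((v + w) / (2 * v * w)))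
      = Real.sqrt (2 * Real.pi * w) * (Real.sqrt (2 * Real.pi * (v + w)))⁻¹ := by
    have hpi := Real.pi_pos
    rw [← Real.sqrt_inv, ← Real.sqrt_inv, ← Real.sqrt_mul (by positivity),
      ← Real.sqrt_mul (by positivity)]
    congr 1
    field_simp
  rw [mul_right_comm, h, mul_assoc]

lemma gaussPDF_pos' (s v : ℝ) (hv : 0 < v) : 0 < gaussPDF s 0 v := by
  unfold gaussPDF
  have hpi := Real.pi_pos
  positivity

/-- Single-source closed form of the AVICA negative log marginal likelihood: with weights
`(lam i)^2` summing to one, weighted average `st`, smoothed density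
`f(s) = −log ∫ exp(−(m/(2σ²)) z²) δ(s − z) dz`, and positive marginal integral
`I = ∫ exp(−(m/(2σ²)) ∑ᵢ λᵢ²(yᵢ − s)²) δ(s) ds`, one has
`−log I = ∑ᵢ (m/(2σ²)) λᵢ² (yᵢ − s̃)² + f(s̃)`; moreover if `δ` is the AVICA
Gaussian-mixture density `½N(·; 0, ½) + ½N(·; 0, 3/2)`, then
`f(s) = −½ log(2πσ²/m) − log(½N(s; 0, ½ + σ²/m) + ½N(s; 0, 3/2 + σ²/m))`. -/
theorem avica_neg_log_likelihood_single_source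
    (δ : ℝ → ℝ) (hδmeas : Measurable δ) (hδnonneg : 0 ≤ δ)
    (hδprob : ∫ u : ℝ, δ u = 1)
    (m : ℕ) (hm : 0 < m) (σ : ℝ) (hσ : 0 < σ)
    (lam y : Fin m → ℝ) (hlam : ∑ i, (lam i) ^ 2 = 1)
    (st : ℝ) (hst : st = ∑ i, (lam i) ^ 2 * y i)
    (f : ℝ → ℝ)
    (hf : ∀ s, f s = -Real.log (∫ z : ℝ,
      Real.exp (-((m : ℝ) / (2 * σ ^ 2)) * z ^ 2) * δ (s - z)))
    (I : ℝ)
    (hI : I = ∫ s : ℝ,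
      Real.exp (-((m : ℝ) / (2 * σ ^ 2)) * ∑ i, (lam i) ^ 2 * (y i - s) ^ 2) * δ s)
    (hIpos : 0 < I) :
    (-Real.log I = (∑ i, ((m : ℝ) / (2 * σ ^ 2)) * (lam i) ^ 2 * (y i - st) ^ 2) + f st)
    ∧ ((δ = fun u => (1 / 2) * gaussPDF u 0 (1 / 2) + (1 / 2) * gaussPDF u 0 (3 / 2)) →
        ∀ s, f s = -(1 / 2) * Real.log (2 * Real.pi * σ ^ 2 / m)
          - Real.log ((1 / 2) * gaussPDF s 0 (1 / 2 + σ ^ 2 / (m : ℝ))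
            + (1 / 2) * gaussPDF s 0 (3 / 2 + σ ^ 2 / (m : ℝ)))) := by
  have hmR : (0 : ℝ) < m := by exact_mod_cast hm
  constructor
  · set a : ℝ := (m : ℝ) / (2 * σ ^ 2) with ha
    have hS : ∀ s, ∑ i, (lam i) ^ 2 * (y i - s) ^ 2
        = ∑ i, (lam i) ^ 2 * (y i - st) ^ 2 + (st - s) ^ 2 := by
      intro s
      have e : ∀ i, (lam i) ^ 2 * (y i - s) ^ 2 = (lam i) ^ 2 * (y i - st) ^ 2
          + (2 * (st - s) * ((lam i) ^ 2 * y i)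
            + ((st - s) ^ 2 - 2 * (st - s) * st) * (lam i) ^ 2) := fun i => by ring
      simp_rw [e]
      rw [Finset.sum_add_distrib, Finset.sum_add_distrib, ← Finset.mul_sum, ← Finset.mul_sum,
        hlam, ← hst]
      ring
    set C : ℝ := ∑ i, (lam i) ^ 2 * (y i - st) ^ 2 with hC
    have hJ : I = Real.exp (-(a * C)) * ∫ z : ℝ, Real.exp (-a * z ^ 2) * δ (st - z) := by
      rw [hI, ← integral_const_mul,
        ← integral_sub_left_eq_self (fun s : ℝ => Real.exp (-a *
          ∑ i, (lam i) ^ 2 * (y i - s) ^ 2) * δ s) volume st]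
      congr 1
      funext z
      simp only [hS]
      rw [← mul_assoc, ← Real.exp_add]
      congr 2
      ring
    have hne : (∫ z : ℝ, Real.exp (-a * z ^ 2) * δ (st - z)) ≠ 0 := by
      intro h0
      rw [h0, mul_zero] at hJ
      exact hIpos.ne' hJ
    have hs : ∑ i, a * (lam i) ^ 2 * (y i - st) ^ 2 = a * C := by
      rw [hC, Finset.mul_sum]
      exact Finset.sum_congr rfl fun i _ => by ring
    rw [hs, hf, hJ, Real.log_mul (Real.exp_pos _).ne' hne, Real.log_exp]
    ring
  · intro hδ s
    have hw : 0 < σ ^ 2 / (m : ℝ) := by positivity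
    have ha : (m : ℝ) / (2 * σ ^ 2) = 1 / (2 * (σ ^ 2 / (m : ℝ))) := by field_simp
    have hp : 2 * Real.pi * σ ^ 2 / (m : ℝ) = 2 * Real.pi * (σ ^ 2 / (m : ℝ)) := by ring
    rw [hf, ha, hp]
    generalize σ ^ 2 / (m : ℝ) = w at hw
    have hpi := Real.pi_pos
    have e : ∀ z, Real.exp (-(1 / (2 * w)) * z ^ 2) * δ (s - z)
        = (1 / 2) * (Real.exp (-(1 / (2 * w)) * z ^ 2) * gaussPDF (s - z) 0 (1 / 2))
          + (1 / 2) * (Real.exp (-(1 / (2 * w)) * z ^ 2) * gaussPDF (s - z) 0 (3 / 2)) := by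
      intro z
      rw [hδ]
      ring
    simp_rw [e]
    rw [integral_add ((gauss_conv_integrable s _ w (by norm_num) hw).const_mul _)
      ((gauss_conv_integrable s _ w (by norm_num) hw).const_mul _),
      integral_const_mul, integral_const_mul,
      gauss_conv_integral s _ w (by norm_num) hw, gauss_conv_integral s _ w (by norm_num) hw]
    have h1 := gaussPDF_pos' s (1 / 2 + w) (by positivity)
    have h2 := gaussPDF_pos' s (3 / 2 + w) (by positivity)
    have hsq : 0 < Real.sqrt (2 * Real.pi * w) := by positivity
    rw [show (1 / 2) * (Real.sqrt (2 * Real.pi * w) * gaussPDF s 0 (1 / 2 + w))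
        + (1 / 2) * (Real.sqrt (2 * Real.pi * w) * gaussPDF s 0 (3 / 2 + w))
        = Real.sqrt (2 * Real.pi * w) * ((1 / 2) * gaussPDF s 0 (1 / 2 + w)
          + (1 / 2) * gaussPDF s 0 (3 / 2 + w)) by ring,
      Real.log_mul hsq.ne' (by positivity), Real.log_sqrt (by positivity)]
    ring
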